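/- Let S⁰ be an adequate semigroup with semilattice of idempotents E⁰, L a left adequate semigroup and R a right adequate semigroup such that S⁰ is a quasi-ideal adequate transversal of both L and R, and let ∗ : R × L → S⁰ satisfy conditions (1) and (2). Then for all a ∈ R and x ∈ L, the elements a∗e_x, a∗x, f_a∗x of S⁰ ⊆ L satisfy (a∗e_x) R* (a∗x) and (a∗x) L* (f_a∗x), the relations R* and L* being computed in L. -/

import Mathlib

/-!
Common framework: "relative" semigroup-theoretic notions.  All notions are taken
relative to a carrier set `U` inside an ambient type, together with an explicit
binary operation `mul` (only the values of `mul` on `U` are relevant).  For an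
honest semigroup `S` one takes `U = Set.univ` and `mul = mulOf S`.

* `RStarOn mul U a b` : the relation `a ℛ* b` computed in `U` with an identity
  adjoined (the two clauses correspond to multipliers from `U` and to the
  adjoined identity).
* `LStarOn`, `GreenLOn`, `GreenROn` : dual / Green's relations.
* `AbundantOn`, `AdequateOn`, `LeftAdequateOn`, `RightAdequateOn`.
* `AdequateTransversalOn mul U S0` : `S0` is an adequate `*`-subsemigroup of `U`
  which is an adequate transversal, with the data `bar x = x̄`, `e x = e_x`,
  `f x = f_x`, and `plus s = s⁺`, `star s = s⋆` for `s ∈ S0`.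
* `InverseTransversalOn mul U S0` : `S0` is an inverse transversal of the
  regular semigroup `U`, with `o x = x⁰` the unique inverse of `x` in `S0`.
-/

namespace Paper

universe u

variable {α : Type*} {β : Type*} {γ : Type*}

def mulOf (α : Type*) [Mul α] : α → α → α := fun a b => a * b

/-- `x` is an idempotent for the operation `mul`. -/
def Idem (mul : α → α → α) (x : α) : Prop := mul x x = x

/-- The relation `ℛ*` on `U` (with an identity adjoined to `U`). -/
def RStarOn (mul : α → α → α) (U : Set α) (a b : α) : Prop :=
  (∀ x ∈ U, ∀ y ∈ U, (mul x a = mul y a ↔ mul x b = mul y b)) ∧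
  (∀ x ∈ U, (mul x a = a ↔ mul x b = b))

/-- The relation `ℒ*` on `U` (with an identity adjoined to `U`). -/
def LStarOn (mul : α → α → α) (U : Set α) (a b : α) : Prop :=
  (∀ x ∈ U, ∀ y ∈ U, (mul a x = mul a y ↔ mul b x = mul b y)) ∧
  (∀ x ∈ U, (mul a x = a ↔ mul b x = b))

/-- Green's relation `ℒ` on `U`: `U¹ a = U¹ b`. -/
def GreenLOn (mul : α → α → α) (U : Set α) (a b : α) : Prop :=
  (a = b ∨ ∃ u ∈ U, mul u b = a) ∧ (b = a ∨ ∃ v ∈ U, mul v a = b)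

/-- Green's relation `ℛ` on `U`: `a U¹ = b U¹`. -/
def GreenROn (mul : α → α → α) (U : Set α) (a b : α) : Prop :=
  (a = b ∨ ∃ u ∈ U, mul b u = a) ∧ (b = a ∨ ∃ v ∈ U, mul a v = b)

/-- `U` is closed under `mul`. -/
def ClosedOn (mul : α → α → α) (U : Set α) : Prop :=
  ∀ a ∈ U, ∀ b ∈ U, mul a b ∈ U

/-- `U` with the operation `mul` is a semigroup. -/
def SemigroupOn (mul : α → α → α) (U : Set α) : Prop :=
  ClosedOn mul U ∧ ∀ a ∈ U, ∀ b ∈ U, ∀ c ∈ U, mul (mul a b) c = mul a (mul b c)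

/-- Every `ℛ*`-class and every `ℒ*`-class of `U` contains an idempotent. -/
def AbundantOn (mul : α → α → α) (U : Set α) : Prop :=
  ∀ a ∈ U, (∃ e ∈ U, Idem mul e ∧ RStarOn mul U a e) ∧
           (∃ f ∈ U, Idem mul f ∧ LStarOn mul U a f)

/-- Abundant with commuting idempotents. -/
def AdequateOn (mul : α → α → α) (U : Set α) : Prop :=
  AbundantOn mul U ∧
    ∀ u ∈ U, ∀ v ∈ U, Idem mul u → Idem mul v → mul u v = mul v u

/-- Abundant, and every `ℛ*`-class contains a unique idempotent. -/
def LeftAdequateOn (mul : α → α → α) (U : Set α) : Prop :=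
  AbundantOn mul U ∧
    ∀ u ∈ U, ∀ v ∈ U, Idem mul u → Idem mul v → RStarOn mul U u v → u = v

/-- Abundant, and every `ℒ*`-class contains a unique idempotent. -/
def RightAdequateOn (mul : α → α → α) (U : Set α) : Prop :=
  AbundantOn mul U ∧
    ∀ u ∈ U, ∀ v ∈ U, Idem mul u → Idem mul v → LStarOn mul U u v → u = v

/-- `S0` is a quasi-ideal of `U` : `S0 U S0 ⊆ S0`. -/
def QuasiIdealOn (mul : α → α → α) (U S0 : Set α) : Prop :=
  ∀ s ∈ S0, ∀ x ∈ U, ∀ t ∈ S0, mul (mul s x) t ∈ S0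

/-- Every element of `U` has an inverse in `U`. -/
def RegularOn (mul : α → α → α) (U : Set α) : Prop :=
  ∀ x ∈ U, ∃ u ∈ U, mul (mul x u) x = x ∧ mul (mul u x) u = u

/-- Regular with commuting idempotents, i.e. an inverse semigroup. -/
def InverseSgpOn (mul : α → α → α) (U : Set α) : Prop :=
  RegularOn mul U ∧
    ∀ u ∈ U, ∀ v ∈ U, Idem mul u → Idem mul v → mul u v = mul v u

/-- Regular, and every Green `ℛ`-class contains a unique idempotent. -/
def LeftInverseSgpOn (mul : α → α → α) (U : Set α) : Prop :=
  RegularOn mul U ∧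
    ∀ u ∈ U, ∀ v ∈ U, Idem mul u → Idem mul v → GreenROn mul U u v → u = v

/-- Regular, and every Green `ℒ`-class contains a unique idempotent. -/
def RightInverseSgpOn (mul : α → α → α) (U : Set α) : Prop :=
  RegularOn mul U ∧
    ∀ u ∈ U, ∀ v ∈ U, Idem mul u → Idem mul v → GreenLOn mul U u v → u = v

/-- An isomorphism from `(A, mulA)` onto `(B, mulB)`. -/
def IsoOn (mulA : α → α → α) (mulB : β → β → β) (A : Set α) (B : Set β) : Prop :=
  ∃ θ : α → β, Set.BijOn θ A B ∧ ∀ a ∈ A, ∀ b ∈ A, θ (mulA a b) = mulB (θ a) (θ b)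

/-- `S0` is an adequate transversal of the abundant semigroup `U`.  `S0` is an
adequate `*`-subsemigroup of `U` (witnessed by `plus`/`star`, the canonical
idempotents `a⁺ ℛ* a`, `a⋆ ℒ* a` of elements of `S0`, the `ℛ*`/`ℒ*` relations
being those of the big semigroup `U`, which gives the `*`-subsemigroup property),
and every `x ∈ U` factors uniquely as `x = e_x x̄ f_x` with `x̄ ∈ S0`,
`e_x, f_x` idempotents of `U`, `e_x ℒ x̄⁺` and `f_x ℛ x̄⋆`. -/
structure AdequateTransversalOn (mul : α → α → α) (U S0 : Set α) where
  sub : S0 ⊆ U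
  mul_mem : ∀ a ∈ S0, ∀ b ∈ S0, mul a b ∈ S0
  bar : α → α
  e : α → α
  f : α → α
  plus : α → α
  star : α → α
  plus_mem : ∀ a ∈ S0, plus a ∈ S0
  plus_idem : ∀ a ∈ S0, Idem mul (plus a)
  plus_rstar : ∀ a ∈ S0, RStarOn mul U a (plus a)
  star_mem : ∀ a ∈ S0, star a ∈ S0
  star_idem : ∀ a ∈ S0, Idem mul (star a)
  star_lstar : ∀ a ∈ S0, LStarOn mul U a (star a)
  idem_comm : ∀ u ∈ S0, ∀ v ∈ S0, Idem mul u → Idem mul v → mul u v = mul v u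
  bar_mem : ∀ x ∈ U, bar x ∈ S0
  e_mem : ∀ x ∈ U, e x ∈ U
  f_mem : ∀ x ∈ U, f x ∈ U
  e_idem : ∀ x ∈ U, Idem mul (e x)
  f_idem : ∀ x ∈ U, Idem mul (f x)
  decomp : ∀ x ∈ U, x = mul (mul (e x) (bar x)) (f x)
  e_greenL : ∀ x ∈ U, GreenLOn mul U (e x) (plus (bar x))
  f_greenR : ∀ x ∈ U, GreenROn mul U (f x) (star (bar x))
  unique : ∀ x ∈ U, ∀ s ∈ S0, ∀ e' ∈ U, ∀ f' ∈ U, Idem mul e' → Idem mul f' →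
      x = mul (mul e' s) f' → GreenLOn mul U e' (plus s) → GreenROn mul U f' (star s) →
      s = bar x ∧ e' = e x ∧ f' = f x

namespace AdequateTransversalOn

variable {mul : α → α → α} {U S0 : Set α}

/-- `R = {x ∈ U : e_x = e_{x̄}}`. -/
def Rset (T : AdequateTransversalOn mul U S0) : Set α :=
  {x | x ∈ U ∧ T.e x = T.e (T.bar x)}

/-- `L = {x ∈ U : f_x = f_{x̄}}`. -/
def Lset (T : AdequateTransversalOn mul U S0) : Set α :=
  {x | x ∈ U ∧ T.f x = T.f (T.bar x)}

/-- `I = {e_x : x ∈ U}`. -/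
def Iset (T : AdequateTransversalOn mul U S0) : Set α :=
  {y | ∃ x ∈ U, T.e x = y}

/-- `Λ = {f_x : x ∈ U}`. -/
def LamSet (T : AdequateTransversalOn mul U S0) : Set α :=
  {y | ∃ x ∈ U, T.f x = y}

/-- The transversal is multiplicative: `Λ I ⊆ E⁰`. -/
def IsMultiplicative (T : AdequateTransversalOn mul U S0) : Prop :=
  ∀ l ∈ T.LamSet, ∀ i ∈ T.Iset, mul l i ∈ S0 ∧ Idem mul (mul l i)

end AdequateTransversalOn

/-- The spined product set `T = L |×| R ⊆ S × S` attached to an adequate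
transversal of `S` (ambient carrier `U`). -/
def spSet {mul : α → α → α} {U S0 : Set α}
    (T : AdequateTransversalOn mul U S0) : Set (α × α) :=
  {p | p.1 ∈ T.Lset ∧ p.2 ∈ T.Rset ∧ T.bar p.1 = T.bar p.2}

/-- The multiplication `(x,a)(y,b) = (e_x(ay), (ay) f_b)` on the spined product. -/
def spMul {mul : α → α → α} {U S0 : Set α}
    (T : AdequateTransversalOn mul U S0) : α × α → α × α → α × α :=
  fun p q => (mul (T.e p.1) (mul p.2 q.1), mul (mul p.2 q.1) (T.f q.2))

/-- The map `φ : S → T`, `x ↦ (e_x x̄, x̄ f_x)`. -/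
def phiMap {mul : α → α → α} {U S0 : Set α}
    (T : AdequateTransversalOn mul U S0) : α → α × α :=
  fun x => (mul (T.e x) (T.bar x), mul (T.bar x) (T.f x))

/-- `T⁰ = {(s,s) : s ∈ S0}`. -/
def diagSet (S0 : Set α) : Set (α × α) := {p | ∃ s ∈ S0, p = (s, s)}

/-- Abstract spined product `L |×| R` over a common transversal `S⁰` (a type `γ`
embedded into `L` and `R` by `jL`, `jR`). -/
def absTset {mulL : α → α → α} {mulR : β → β → β} {jL : γ → α} {jR : γ → β}
    (TL : AdequateTransversalOn mulL Set.univ (Set.range jL))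
    (TR : AdequateTransversalOn mulR Set.univ (Set.range jR)) : Set (α × β) :=
  {p | ∃ s : γ, jL s = TL.bar p.1 ∧ jR s = TR.bar p.2}

/-- The multiplication `(x,a)(y,b) = (e_x(a∗y), (a∗y) f_b)`. -/
def absMul {mulL : α → α → α} {mulR : β → β → β} {jL : γ → α} {jR : γ → β}
    (TL : AdequateTransversalOn mulL Set.univ (Set.range jL))
    (TR : AdequateTransversalOn mulR Set.univ (Set.range jR))
    (st : β → α → γ) : α × β → α × β → α × β :=
  fun p q => (mulL (TL.e p.1) (jL (st p.2 q.1)), mulR (jR (st p.2 q.1)) (TR.f q.2))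

/-- `T⁰ = {(s,s) : s ∈ S⁰}` inside `L × R`, where `s` is viewed in `L` and in `R`. -/
def absT0 (jL : γ → α) (jR : γ → β) : Set (α × β) :=
  {p | ∃ s : γ, p = (jL s, jR s)}

/-- `S0` is an inverse transversal of the regular semigroup `U`: an inverse
subsemigroup meeting the set of inverses of each `x ∈ U` in exactly one
element `o x = x⁰`. -/
structure InverseTransversalOn (mul : α → α → α) (U S0 : Set α) where
  sub : S0 ⊆ U
  mul_mem : ∀ a ∈ S0, ∀ b ∈ S0, mul a b ∈ S0
  o : α → α
  o_mem : ∀ x ∈ U, o x ∈ S0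
  o_inv1 : ∀ x ∈ U, mul (mul x (o x)) x = x
  o_inv2 : ∀ x ∈ U, mul (mul (o x) x) (o x) = o x
  o_unique : ∀ x ∈ U, ∀ u ∈ S0, mul (mul x u) x = x → mul (mul u x) u = u → u = o x
  idem_comm : ∀ u ∈ S0, ∀ v ∈ S0, Idem mul u → Idem mul v → mul u v = mul v u

namespace InverseTransversalOn

variable {mul : α → α → α} {U S0 : Set α}

/-- `L = {x ∈ U : x⁰x ∈ E⁰}`. -/
def LsetI (T : InverseTransversalOn mul U S0) : Set α :=
  {x | x ∈ U ∧ mul (T.o x) x ∈ S0 ∧ Idem mul (mul (T.o x) x)}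

/-- `R = {x ∈ U : xx⁰ ∈ E⁰}`. -/
def RsetI (T : InverseTransversalOn mul U S0) : Set α :=
  {x | x ∈ U ∧ mul x (T.o x) ∈ S0 ∧ Idem mul (mul x (T.o x))}

end InverseTransversalOn

/-- Spined product set for an inverse transversal: `{(x,a) : x⁰ = a⁰}`. -/
def invSpSet {mul : α → α → α} {U S0 : Set α}
    (T : InverseTransversalOn mul U S0) : Set (α × α) :=
  {p | p.1 ∈ T.LsetI ∧ p.2 ∈ T.RsetI ∧ T.o p.1 = T.o p.2}

/-- The multiplication `(x,a)(y,b) = ((xx⁰)(ay), (ay)(b⁰b))`. -/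
def invSpMul {mul : α → α → α} {U S0 : Set α}
    (T : InverseTransversalOn mul U S0) : α × α → α × α → α × α :=
  fun p q => (mul (mul p.1 (T.o p.1)) (mul p.2 q.1),
              mul (mul p.2 q.1) (mul (T.o q.2) q.2))

/-- Abstract spined product for inverse transversals: `{(x,a) : x⁰ = a⁰}`. -/
def invAbsTset {mulL : α → α → α} {mulR : β → β → β} {jL : γ → α} {jR : γ → β}
    (TL : InverseTransversalOn mulL Set.univ (Set.range jL))
    (TR : InverseTransversalOn mulR Set.univ (Set.range jR)) : Set (α × β) :=
  {p | ∃ s : γ, jL s = TL.o p.1 ∧ jR s = TR.o p.2}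

/-- The multiplication `(x,a)(y,b) = ((xx⁰)(a∗y), (a∗y)(b⁰b))`. -/
def invAbsMul {mulL : α → α → α} {mulR : β → β → β} {jL : γ → α} {jR : γ → β}
    (TL : InverseTransversalOn mulL Set.univ (Set.range jL))
    (TR : InverseTransversalOn mulR Set.univ (Set.range jR))
    (st : β → α → γ) : α × β → α × β → α × β :=
  fun p q => (mulL (mulL p.1 (TL.o p.1)) (jL (st p.2 q.1)),
              mulR (jR (st p.2 q.1)) (mulR (TR.o q.2) q.2))

/-- The multiplication `(e,x)(g,w) = (e(aa⁻¹), a)`, `a = x((x⁻¹x)g)w`, on `I × S⁰`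
(Chen-style construction from a left normal band `I` with semilattice transversal
`E⁰ = E(S⁰)`; `σ` embeds idempotents of the inverse semigroup `γ` into the band
`β`, and `π : β → γ` is the semilattice-transversal map `e ↦ e⁰`). -/
def bandMul (mulB : β → β → β) (mulG : γ → γ → γ) (σ : γ → β) (π : β → γ)
    (inv : γ → γ) (p q : β × γ) : β × γ :=
  let a := mulG (mulG p.2 (π (mulB (σ (mulG (inv p.2) p.2)) q.1))) q.2
  (mulB p.1 (σ (mulG a (inv a))), a)

/-- `T = {(e,x) : e⁰ = xx⁻¹}`. -/
def bandTset (mulG : γ → γ → γ) (π : β → γ) (inv : γ → γ) : Set (β × γ) :=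
  {p | π p.1 = mulG p.2 (inv p.2)}

/-- `T⁰ = {(aa⁻¹, a) : a ∈ S⁰}` (with `aa⁻¹` viewed in the band via `σ`). -/
def bandT0 (mulG : γ → γ → γ) (σ : γ → β) (inv : γ → γ) : Set (β × γ) :=
  {p | ∃ s : γ, p = (σ (mulG s (inv s)), s)}

end Paper

namespace Paper

section

variable {S : Type*} [Semigroup S]

theorem GreenLOn.mul_eq {e p : S} (hp : Idem (mulOf S) p)
    (h : GreenLOn (mulOf S) Set.univ e p) : e * p = e := by
  change p * p = p at hp
  rcases h.1 with rfl | ⟨u, -, hu⟩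
  · exact hp
  · change u * p = e at hu
    rw [← hu, mul_assoc, hp]

theorem GreenROn.mul_eq {f q : S} (hq : Idem (mulOf S) q)
    (h : GreenROn (mulOf S) Set.univ f q) : q * f = f := by
  change q * q = q at hq
  rcases h.1 with rfl | ⟨u, -, hu⟩
  · exact hq
  · change q * u = f at hu
    rw [← hu, ← mul_assoc, hq]

theorem GreenLOn.lStarOn {a b : S} (h : GreenLOn (mulOf S) Set.univ a b) :
    LStarOn (mulOf S) Set.univ a b := by
  obtain ⟨rfl | ⟨u, -, hu⟩, h₂⟩ := h
  · exact ⟨fun _ _ _ _ => Iff.rfl, fun _ _ => Iff.rfl⟩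
  obtain rfl | ⟨v, -, hv⟩ := h₂
  · exact ⟨fun _ _ _ _ => Iff.rfl, fun _ _ => Iff.rfl⟩
  change u * b = a at hu
  change v * a = b at hv
  refine ⟨fun x _ y _ => ⟨fun h => ?_, fun h => ?_⟩, fun x _ => ⟨fun h => ?_, fun h => ?_⟩⟩
  · change a * x = a * y at h
    change b * x = b * y
    rw [← hv, mul_assoc, h, mul_assoc]
  · change b * x = b * y at h
    change a * x = a * y
    rw [← hu, mul_assoc, h, mul_assoc]
  · change a * x = a at h
    change b * x = b
    rw [← hv, mul_assoc, h]
  · change b * x = b at h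
    change a * x = a
    rw [← hu, mul_assoc, h]

theorem GreenROn.rStarOn {a b : S} (h : GreenROn (mulOf S) Set.univ a b) :
    RStarOn (mulOf S) Set.univ a b := by
  obtain ⟨rfl | ⟨u, -, hu⟩, h₂⟩ := h
  · exact ⟨fun _ _ _ _ => Iff.rfl, fun _ _ => Iff.rfl⟩
  obtain rfl | ⟨v, -, hv⟩ := h₂
  · exact ⟨fun _ _ _ _ => Iff.rfl, fun _ _ => Iff.rfl⟩
  change b * u = a at hu
  change a * v = b at hv
  refine ⟨fun x _ y _ => ⟨fun h => ?_, fun h => ?_⟩, fun x _ => ⟨fun h => ?_, fun h => ?_⟩⟩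
  · change x * a = y * a at h
    change x * b = y * b
    rw [← hv, ← mul_assoc, h, mul_assoc]
  · change x * b = y * b at h
    change x * a = y * a
    rw [← hu, ← mul_assoc, h, mul_assoc]
  · change x * a = a at h
    change x * b = b
    rw [← hv, ← mul_assoc, h]
  · change x * b = b at h
    change x * a = a
    rw [← hu, ← mul_assoc, h]

/-- `ℛ*` is a left congruence. -/
theorem RStarOn.mul_left {a b : S} (h : RStarOn (mulOf S) Set.univ a b) (c : S) :
    RStarOn (mulOf S) Set.univ (c * a) (c * b) := by
  refine ⟨fun x _ y _ => ?_, fun x _ => ?_⟩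
  · simpa only [mulOf, mul_assoc] using h.1 (x * c) trivial (y * c) trivial
  · simpa only [mulOf, mul_assoc] using h.1 (x * c) trivial c trivial

/-- `ℒ*` is a right congruence. -/
theorem LStarOn.mul_right {a b : S} (h : LStarOn (mulOf S) Set.univ a b) (c : S) :
    LStarOn (mulOf S) Set.univ (a * c) (b * c) := by
  refine ⟨fun x _ y _ => ?_, fun x _ => ?_⟩
  · simpa only [mulOf, mul_assoc] using h.1 (c * x) trivial (c * y) trivial
  · simpa only [mulOf, mul_assoc] using h.1 (c * x) trivial c trivial

namespace AdequateTransversalOn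

variable {S0 : Set S} (T : AdequateTransversalOn (mulOf S) Set.univ S0)

theorem plus_mul {s : S} (hs : s ∈ S0) : T.plus s * s = s :=
  ((T.plus_rstar s hs).2 _ trivial).2 (T.plus_idem s hs)

theorem mul_star {s : S} (hs : s ∈ S0) : s * T.star s = s :=
  ((T.star_lstar s hs).2 _ trivial).2 (T.star_idem s hs)

theorem plus_eq_self {p : S} (hp : p ∈ S0) (hi : Idem (mulOf S) p) : T.plus p = p :=
  calc T.plus p = p * T.plus p := (((T.plus_rstar p hp).2 p trivial).1 hi).symm
    _ = T.plus p * p := T.idem_comm _ hp _ (T.plus_mem p hp) hi (T.plus_idem p hp)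
    _ = p := T.plus_mul hp

theorem star_eq_self {p : S} (hp : p ∈ S0) (hi : Idem (mulOf S) p) : T.star p = p :=
  calc T.star p = T.star p * p := (((T.star_lstar p hp).2 p trivial).1 hi).symm
    _ = p * T.star p := T.idem_comm _ (T.star_mem p hp) _ hp (T.star_idem p hp) hi
    _ = p := T.mul_star hp

/-- An idempotent `e` that is `ℒ`-related to `p ∈ E⁰` has `ē = f_e = p` and `e_e = e`. -/
theorem bar_e_f_of_greenL {e p : S} (hp : p ∈ S0) (hi : Idem (mulOf S) p)
    (he : Idem (mulOf S) e) (h : GreenLOn (mulOf S) Set.univ e p) :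
    p = T.bar e ∧ e = T.e e ∧ p = T.f e := by
  refine T.unique e trivial p hp e trivial p trivial he hi ?_ ?_ ?_
  · change e = e * p * p
    rw [h.mul_eq hi, h.mul_eq hi]
  · rwa [T.plus_eq_self hp hi]
  · rw [T.star_eq_self hp hi]
    exact ⟨Or.inl rfl, Or.inl rfl⟩

/-- An idempotent `f` that is `ℛ`-related to `q ∈ E⁰` has `f̄ = e_f = q` and `f_f = f`. -/
theorem bar_e_f_of_greenR {f q : S} (hq : q ∈ S0) (hi : Idem (mulOf S) q)
    (hf : Idem (mulOf S) f) (h : GreenROn (mulOf S) Set.univ f q) :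
    q = T.bar f ∧ q = T.e f ∧ f = T.f f := by
  refine T.unique f trivial q hq q trivial f trivial hi hf ?_ ?_ ?_
  · change f = q * q * f
    rw [mul_assoc, h.mul_eq hi, h.mul_eq hi]
  · rw [T.plus_eq_self hq hi]
    exact ⟨Or.inl rfl, Or.inl rfl⟩
  · rwa [T.star_eq_self hq hi]

theorem bar_e_f_of_idem {p : S} (hp : p ∈ S0) (hi : Idem (mulOf S) p) :
    p = T.bar p ∧ p = T.e p ∧ p = T.f p :=
  T.bar_e_f_of_greenL hp hi hi ⟨Or.inl rfl, Or.inl rfl⟩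

theorem eq_e_mul_bar (hS : LeftAdequateOn (mulOf S) Set.univ) (x : S) :
    x = T.e x * T.bar x := by
  have hb := T.bar_mem x trivial
  have hf : T.f x = T.star (T.bar x) :=
    hS.2 _ trivial _ trivial (T.f_idem x trivial) (T.star_idem _ hb)
      (T.f_greenR x trivial).rStarOn
  have hd : x = T.e x * T.bar x * T.f x := T.decomp x trivial
  rwa [hf, mul_assoc, T.mul_star hb] at hd

theorem eq_bar_mul_f (hS : RightAdequateOn (mulOf S) Set.univ) (x : S) :
    x = T.bar x * T.f x := by
  have hb := T.bar_mem x trivial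
  have he : T.e x = T.plus (T.bar x) :=
    hS.2 _ trivial _ trivial (T.e_idem x trivial) (T.plus_idem _ hb)
      (T.e_greenL x trivial).lStarOn
  have hd : x = T.e x * T.bar x * T.f x := T.decomp x trivial
  rwa [he, T.plus_mul hb] at hd

end AdequateTransversalOn

end

/-- The idempotent `s⋆` does not depend on the semigroup in which `S⁰` is a transversal. -/
theorem star_transfer {L R G : Type*} [Semigroup L] [Semigroup R] [Semigroup G]
    {jL : G → L} {jR : G → R}
    (hjL : Function.Injective jL) (hjR : Function.Injective jR)
    (hjLm : ∀ s t : G, jL (s * t) = jL s * jL t)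
    (hjRm : ∀ s t : G, jR (s * t) = jR s * jR t)
    (TL : AdequateTransversalOn (mulOf L) Set.univ (Set.range jL))
    (TR : AdequateTransversalOn (mulOf R) Set.univ (Set.range jR))
    {t q : G} (hq : jR q = TR.star (jR t)) : jL q = TL.star (jL t) := by
  obtain ⟨r, hr⟩ := TL.star_mem (jL t) ⟨t, rfl⟩
  have hqi : Idem (mulOf R) (jR q) := hq ▸ TR.star_idem _ ⟨t, rfl⟩
  have hri : Idem (mulOf L) (jL r) := hr ▸ TL.star_idem _ ⟨t, rfl⟩
  have htq : t * q = t := hjR (by rw [hjRm, hq]; exact TR.mul_star ⟨t, rfl⟩)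
  have htr : t * r = t := hjL (by rw [hjLm, hr]; exact TL.mul_star ⟨t, rfl⟩)
  have hqr : q * r = q := hjR (by
    rw [hjRm, hq]
    exact ((TR.star_lstar (jR t) ⟨t, rfl⟩).2 (jR r) trivial).1
      ((hjRm t r).symm.trans (congrArg jR htr)))
  have hrq : r * q = r := hjL (by
    rw [hjLm, hr]
    exact ((TL.star_lstar (jL t) ⟨t, rfl⟩).2 (jL q) trivial).1
      ((hjLm t q).symm.trans (congrArg jL htq)))
  have hqi' : Idem (mulOf L) (jL q) := by
    have hqq : q * q = q := hjR ((hjRm q q).trans hqi)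
    exact (hjLm q q).symm.trans (congrArg jL hqq)
  have hc : jL q * jL r = jL r * jL q := TL.idem_comm _ ⟨q, rfl⟩ _ ⟨r, rfl⟩ hqi' hri
  rw [← hjLm, ← hjLm, hqr, hrq] at hc
  rw [hc, hr]

end Paper

open Paper in
/-- **Lemma `sub-R-S-L-lemma`.** For `a ∈ R`, `x ∈ L`,
`(a∗e_x) ℛ*_L (a∗x) ℒ*_L (f_a∗x)` (the elements of `S⁰` viewed in `L` via `jL`,
the relations `ℛ*`, `ℒ*` computed in `L`). -/
theorem stmt12 {L R G : Type u} [Semigroup L] [Semigroup R] [Semigroup G]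
    (jL : G → L) (jR : G → R)
    (hjL : Function.Injective jL) (hjR : Function.Injective jR)
    (hjLm : ∀ s t : G, jL (s * t) = jL s * jL t)
    (hjRm : ∀ s t : G, jR (s * t) = jR s * jR t)
    (hG : AdequateOn (mulOf G) Set.univ)
    (hL : LeftAdequateOn (mulOf L) Set.univ)
    (hR : RightAdequateOn (mulOf R) Set.univ)
    (TL : AdequateTransversalOn (mulOf L) Set.univ (Set.range jL))
    (TR : AdequateTransversalOn (mulOf R) Set.univ (Set.range jR))
    (hQL : QuasiIdealOn (mulOf L) Set.univ (Set.range jL))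
    (hQR : QuasiIdealOn (mulOf R) Set.univ (Set.range jR))
    (st : R → L → G)
    (cond1 : ∀ (y z : L) (a b : R),
      (∃ s : G, jL s = TL.bar y ∧ jR s = TR.bar b) →
      st (jR (st a y) * TR.f b) z = st a (TL.e y * jL (st b z)))
    (cond2L : ∀ (s : G) (x : L), jL (st (jR s) x) = jL s * x)
    (cond2R : ∀ (a : R) (s : G), jR (st a (jL s)) = a * jR s)
    :
    ∀ (a : R) (x : L),
      RStarOn (mulOf L) Set.univ (jL (st a (TL.e x))) (jL (st a x)) ∧
      LStarOn (mulOf L) Set.univ (jL (st a x)) (jL (st (TR.f a) x)) := by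
  intro a x
  have idem_G {p : G} (hp : Idem (mulOf L) (jL p)) : p * p = p :=
    hjL ((hjLm p p).trans hp)
  have idem_R {p : G} (hp : p * p = p) : Idem (mulOf R) (jR p) :=
    (hjRm p p).symm.trans (congrArg jR hp)
  have st_G (s t : G) : st (jR s) (jL t) = s * t :=
    hjL ((cond2L s (jL t)).trans (hjLm s t).symm)
  constructor
  · obtain ⟨s, hs⟩ := TL.bar_mem x trivial
    obtain ⟨p, hp⟩ := TL.plus_mem (TL.bar x) ⟨s, hs⟩
    have hpi : Idem (mulOf L) (jL p) := hp ▸ TL.plus_idem _ ⟨s, hs⟩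
    have hpp := idem_G hpi
    have hex : GreenLOn (mulOf L) Set.univ (TL.e x) (jL p) := hp ▸ TL.e_greenL x trivial
    obtain ⟨hbar, he, -⟩ := TL.bar_e_f_of_greenL ⟨p, rfl⟩ hpi (TL.e_idem x trivial) hex
    obtain ⟨hbarR, -, hfR⟩ := TR.bar_e_f_of_idem ⟨p, rfl⟩ (idem_R hpp)
    have key (w : G) : st a (TL.e x) * (p * w) = st a (TL.e x * jL (p * w)) := by
      have h := cond1 (TL.e x) (jL w) a (jR p) ⟨p, hbar, hbarR⟩
      rwa [← hfR, ← hjRm, st_G, st_G, ← he, mul_assoc] at h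
    have hps : p * s = s := hjL (by
      rw [hjLm, hp, hs]
      exact TL.plus_mul ⟨s, hs⟩)
    have h₁ : st a (TL.e x) * p = st a (TL.e x) := by
      have h := key p
      rwa [hpp, hex.mul_eq hpi] at h
    have h₂ : st a (TL.e x) * s = st a x := by
      have h := key s
      rwa [hps, hs, ← TL.eq_e_mul_bar hL x] at h
    have hsp : RStarOn (mulOf L) Set.univ (jL p) (jL s) := by
      have h := TL.plus_rstar (TL.bar x) ⟨s, hs⟩
      rw [← hp, ← hs] at h
      exact ⟨fun u hu v hv => (h.1 u hu v hv).symm, fun u hu => (h.2 u hu).symm⟩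
    have h := hsp.mul_left (jL (st a (TL.e x)))
    rwa [← hjLm, ← hjLm, h₁, h₂] at h
  · obtain ⟨t, ht⟩ := TR.bar_mem a trivial
    obtain ⟨q, hq⟩ := TR.star_mem (TR.bar a) ⟨t, ht⟩
    have hqL : jL q = TL.star (jL t) :=
      star_transfer hjL hjR hjLm hjRm TL TR (hq.trans (by rw [ht]))
    have hqi : Idem (mulOf L) (jL q) := hqL ▸ TL.star_idem _ ⟨t, rfl⟩
    have hqq := idem_G hqi
    have hfa : GreenROn (mulOf R) Set.univ (TR.f a) (jR q) := hq ▸ TR.f_greenR a trivial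
    obtain ⟨hbar, -, hf⟩ :=
      TR.bar_e_f_of_greenR ⟨q, rfl⟩ (idem_R hqq) (TR.f_idem a trivial) hfa
    obtain ⟨hbarL, heL, -⟩ := TL.bar_e_f_of_idem ⟨q, rfl⟩ hqi
    have key (w : G) : st (jR (w * q) * TR.f a) x = w * q * st (TR.f a) x := by
      have h := cond1 (jL q) x (jR w) (TR.f a) ⟨q, hbarL, hbar⟩
      rwa [← hf, ← heL, ← hjLm, st_G, st_G, ← mul_assoc] at h
    have htq : t * q = t := hjL (by
      rw [hjLm, hqL]
      exact TL.mul_star ⟨t, rfl⟩)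
    have h₁ : st (TR.f a) x = q * st (TR.f a) x := by
      have h := key q
      rwa [hqq, hfa.mul_eq (idem_R hqq)] at h
    have h₂ : st a x = t * st (TR.f a) x := by
      have h := key t
      rwa [htq, ht, ← TR.eq_bar_mul_f hR a] at h
    have htl : LStarOn (mulOf L) Set.univ (jL t) (jL q) := hqL ▸ TL.star_lstar _ ⟨t, rfl⟩
    have h := htl.mul_right (jL (st (TR.f a) x))
    rwa [← hjLm, ← hjLm, ← h₁, ← h₂] at h
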